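/- arXiv:2302.00524 — 3 statements merged into one kernel-verified Lean document; each statement's English description precedes it below -/
import Mathlib

section
/- Fix α ≥ 1 and v₀ ∈ ℝ with v₀ ≠ 0, and let u, x : ℝ → ℝ be functions with x twice differentiable, satisfying x'(t) = u(t) and u'(t) = −α v₀² |x(t)|^{2(α−1)} x(t) for all t. Let p_{b0}, k₁, k₂ ∈ ℝ and set k₃ := ((α−1)v₀k₁ + p_{b0})/v₀. Then the function x_a(t) := k₁ x(t) + (k₂ + k₃ t) u(t) is twice differentiable and satisfies the Jacobi equation x_a''(t) + α v₀ |x(t)|^{2(α−1)} ( 2 p_{b0} x(t) + (2α−1) v₀ x_a(t) ) = 0 for all t ∈ ℝ. -/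
/-- The derivative of `|z| ^ p * z` is `(p + 1) * |z| ^ p` for every `p ≥ 0`, also at `0`. -/
theorem hasDerivAt_abs_rpow_mul_self {p : ℝ} (hp : 0 ≤ p) (y : ℝ) :
    HasDerivAt (fun z : ℝ => |z| ^ p * z) ((p + 1) * |y| ^ p) y := by
  rcases eq_or_ne y 0 with rfl | hy
  · have hc : Continuous fun z : ℝ => |z| ^ p := continuous_abs.rpow_const fun _ => Or.inr hp
    have hval : (p + 1) * |(0 : ℝ)| ^ p = |(0 : ℝ)| ^ p := by
      rcases hp.eq_or_lt with rfl | hp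
      · simp
      · simp [Real.zero_rpow hp.ne']
    rw [hval, hasDerivAt_iff_tendsto_slope]
    refine ((hc.tendsto 0).mono_left nhdsWithin_le_nhds).congr' ?_
    filter_upwards [self_mem_nhdsWithin] with z hz
    have hz : z ≠ 0 := hz
    simp [slope_def_field, hz]
  · have hy' : 0 < |y| := abs_pos.mpr hy
    have hsign : (SignType.sign y : ℝ) * y = |y| := sign_mul_self y
    have hpow : |y| ^ (p - 1) * |y| = |y| ^ p := by
      rw [← Real.rpow_add_one hy'.ne', sub_add_cancel]
    refine (((hasDerivAt_abs hy).rpow_const (p := p) (Or.inl hy'.ne')).mul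
      (hasDerivAt_id y)).congr_deriv ?_
    simp only [id]
    linear_combination p * hpow + p * |y| ^ (p - 1) * hsign

/-- The ansatz `x_a(t) = k₁ x(t) + (k₂ + k₃ t) u(t)`, with
`k₃ = ((α-1) v₀ k₁ + p_{b0}) / v₀`, solves the Jacobi equation
`x_a'' + α v₀ |x|^(2(α-1)) (2 p_{b0} x + (2α-1) v₀ x_a) = 0`
along a solution of the α-Grushin geodesic equations. -/
theorem alpha_grushin_jacobi_ansatz (α : ℝ) (hα : 1 ≤ α) (v₀ : ℝ) (hv₀ : v₀ ≠ 0)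
    (u x : ℝ → ℝ)
    (hx : ∀ t, HasDerivAt x (u t) t)
    (hu : ∀ t, HasDerivAt u (-α * v₀ ^ 2 * |x t| ^ (2 * (α - 1)) * x t) t)
    (pb0 k₁ k₂ k₃ : ℝ) (hk₃ : k₃ = ((α - 1) * v₀ * k₁ + pb0) / v₀) :
    ∃ xa' : ℝ → ℝ,
      (∀ t, HasDerivAt (fun s => k₁ * x s + (k₂ + k₃ * s) * u s) (xa' t) t) ∧
      (∀ t, HasDerivAt xa'
        (-(α * v₀ * |x t| ^ (2 * (α - 1)) *
            (2 * pb0 * x t + (2 * α - 1) * v₀ * (k₁ * x t + (k₂ + k₃ * t) * u t)))) t) := by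
  have hk : k₃ * v₀ = (α - 1) * v₀ * k₁ + pb0 := by rw [hk₃, div_mul_cancel₀ _ hv₀]
  have hlin (t : ℝ) : HasDerivAt (fun s => k₂ + k₃ * s) k₃ t := by
    simpa using ((hasDerivAt_id t).const_mul k₃).const_add k₂
  have hforce (t : ℝ) : HasDerivAt (fun s => |x s| ^ (2 * (α - 1)) * x s)
      ((2 * (α - 1) + 1) * |x t| ^ (2 * (α - 1)) * u t) t :=
    (hasDerivAt_abs_rpow_mul_self (by linarith) (x t)).comp t (hx t)
  refine ⟨fun t => (k₁ + k₃) * u t +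
    (k₂ + k₃ * t) * (-α * v₀ ^ 2 * (|x t| ^ (2 * (α - 1)) * x t)), fun t => ?_, fun t => ?_⟩
  · refine (((hx t).const_mul k₁).add ((hlin t).mul (hu t))).congr_deriv ?_
    ring
  · refine (((hu t).const_mul (k₁ + k₃)).add
      ((hlin t).mul ((hforce t).const_mul (-α * v₀ ^ 2)))).congr_deriv ?_
    linear_combination -2 * α * v₀ * |x t| ^ (2 * (α - 1)) * x t * hk
end

section
/- Fix α ≥ 1 and v₀ ∈ ℝ, and let u, x : ℝ → ℝ be differentiable functions satisfying x'(t) = u(t) and u'(t) = −α v₀² |x(t)|^{2(α−1)} x(t) for all t. Set u₀ := u(0), x₀ := x(0) and 2H := u₀² + v₀² |x₀|^{2α}. Then for every t ∈ ℝ, ∫₀ᵗ s·u(s)·u'(s) ds = ( u₀x₀ − α t·2H + (α+1) t u(t)² − u(t) x(t) ) / (2(α+1)). -/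
theorem abs_rpow_mul_self_mul_self {α : ℝ} (hα : 0 < α) (x : ℝ) :
    |x| ^ (2 * (α - 1)) * x * x = |x| ^ (2 * α) := by
  rcases eq_or_ne x 0 with rfl | hx
  · rw [abs_zero, Real.zero_rpow (by positivity : 2 * α ≠ 0), mul_zero]
  · have h : |x| ^ (2 * α) = |x| ^ (2 * (α - 1)) * |x| ^ (2 : ℝ) := by
      rw [← Real.rpow_add (abs_pos.2 hx)]
      ring_nf
    rw [h, Real.rpow_two, sq_abs]
    ring

/-- The Hamiltonian is conserved along solutions of the α-Grushin geodesic equations. -/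
theorem alpha_grushin_energy_eq {α : ℝ} (hα : 1 ≤ α) {v₀ : ℝ} {u x : ℝ → ℝ}
    (hx : ∀ t, HasDerivAt x (u t) t)
    (hu : ∀ t, HasDerivAt u (-α * v₀ ^ 2 * |x t| ^ (2 * (α - 1)) * x t) t) (t : ℝ) :
    u t ^ 2 + v₀ ^ 2 * |x t| ^ (2 * α) = u 0 ^ 2 + v₀ ^ 2 * |x 0| ^ (2 * α) := by
  have key (s : ℝ) : HasDerivAt (fun s ↦ u s ^ 2 + v₀ ^ 2 * |x s| ^ (2 * α)) 0 s := by
    have h := (hasDerivAt_abs_rpow (x s) (by linarith : 1 < 2 * α)).comp s (hx s)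
    refine (((hu s).pow 2).add (h.const_mul (v₀ ^ 2))).congr_deriv ?_
    rw [show 2 * α - 2 = 2 * (α - 1) by ring]
    push_cast
    ring
  exact is_const_of_deriv_eq_zero (fun s ↦ (key s).differentiableAt) (fun s ↦ (key s).deriv) t 0

/-- The integral identity `∫₀ᵗ s u(s) u'(s) ds
= (u₀x₀ - α t 2H + (α+1) t u(t)² - u(t)x(t)) / (2(α+1))` along a solution of the
α-Grushin geodesic equations, where `2H = u₀² + v₀² |x₀|^(2α)`. -/
theorem alpha_grushin_integral_identity (α : ℝ) (hα : 1 ≤ α) (v₀ : ℝ) (u x : ℝ → ℝ)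
    (hx : ∀ t, HasDerivAt x (u t) t)
    (hu : ∀ t, HasDerivAt u (-α * v₀ ^ 2 * |x t| ^ (2 * (α - 1)) * x t) t) :
    ∀ t : ℝ,
      ∫ s in (0:ℝ)..t, s * u s * (-α * v₀ ^ 2 * |x s| ^ (2 * (α - 1)) * x s) =
        (u 0 * x 0 - α * t * ((u 0) ^ 2 + v₀ ^ 2 * |x 0| ^ (2 * α))
          + (α + 1) * t * (u t) ^ 2 - u t * x t) / (2 * (α + 1)) := by
  intro t
  have hα1 : α + 1 ≠ 0 := by linarith
  have hxc : Continuous x := continuous_iff_continuousAt.2 fun s ↦ (hx s).continuousAt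
  have huc : Continuous u := continuous_iff_continuousAt.2 fun s ↦ (hu s).continuousAt
  have hpow : Continuous fun s ↦ |x s| ^ (2 * (α - 1)) :=
    hxc.abs.rpow_const fun _ ↦ Or.inr (by linarith)
  have key (s : ℝ) : HasDerivAt (fun s ↦ (u 0 * x 0
      - α * s * (u 0 ^ 2 + v₀ ^ 2 * |x 0| ^ (2 * α))
      + (α + 1) * s * u s ^ 2 - u s * x s) / (2 * (α + 1)))
      (s * u s * (-α * v₀ ^ 2 * |x s| ^ (2 * (α - 1)) * x s)) s := by
    have h1 := (((hasDerivAt_id s).const_mul α).mul_const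
      (u 0 ^ 2 + v₀ ^ 2 * |x 0| ^ (2 * α))).const_sub (u 0 * x 0)
    have h2 := ((hasDerivAt_id s).const_mul (α + 1)).mul ((hu s).pow 2)
    refine (((h1.add h2).sub ((hu s).mul (hx s))).div_const (2 * (α + 1))).congr_deriv ?_
    rw [← alpha_grushin_energy_eq hα hx hu s, ← abs_rpow_mul_self_mul_self (by linarith) (x s)]
    simp only [id, Pi.pow_apply]
    field_simp
    push_cast
    ring
  rw [intervalIntegral.integral_eq_sub_of_hasDerivAt (fun s _ ↦ key s)
    (Continuous.intervalIntegrable (by fun_prop) _ _)]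
  simp
end

section
/- Let U := {(u, v, w) ∈ ℝ³ : w² − u² − v² > 0} and define f₀ : U → ℝ by f₀(u, v, w) := √r cos(√r/2) − 2 sin(√r/2) where r := w² − u² − v². Then f₀ is Fréchet differentiable at every point of U with derivative the linear map (du, dv, dw) ↦ (1/2) sin(√r/2) (u·du + v·dv − w·dw). Moreover, at every point of U where f₀ vanishes, this derivative is a nonzero linear functional; hence 0 is a regular value of f₀ on U. -/
theorem hasDerivAt_mul_cos_half_sub_two_mul_sin_half (s : ℝ) :
    HasDerivAt (fun t : ℝ => t * Real.cos (t / 2) - 2 * Real.sin (t / 2))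
      (-(s / 2) * Real.sin (s / 2)) s := by
  have h : HasDerivAt (fun t : ℝ => t / 2) (1 / 2) s := (hasDerivAt_id s).div_const 2
  refine (((hasDerivAt_id s).mul h.cos).sub (h.sin.const_mul 2)).congr_deriv ?_
  simp only [id]
  ring

theorem sin_half_ne_zero_of_mul_cos_half_sub_two_mul_sin_half_eq_zero {s : ℝ} (hs : s ≠ 0)
    (h : s * Real.cos (s / 2) - 2 * Real.sin (s / 2) = 0) : Real.sin (s / 2) ≠ 0 := by
  intro hsin
  have hcos : Real.cos (s / 2) = 0 := by simpa [hsin, hs] using h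
  simpa [hsin, hcos] using Real.sin_sq_add_cos_sq (s / 2)

theorem hasFDerivAt_lorentz_sq (p : Fin 3 → ℝ) :
    HasFDerivAt (fun q : Fin 3 → ℝ => q 2 ^ 2 - q 0 ^ 2 - q 1 ^ 2)
      ((-2 : ℝ) • (p 0 • (ContinuousLinearMap.proj 0 : (Fin 3 → ℝ) →L[ℝ] ℝ)
            + p 1 • (ContinuousLinearMap.proj 1 : (Fin 3 → ℝ) →L[ℝ] ℝ)
            - p 2 • (ContinuousLinearMap.proj 2 : (Fin 3 → ℝ) →L[ℝ] ℝ))) p := by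
  have h (i : Fin 3) : HasFDerivAt (fun q : Fin 3 → ℝ => q i ^ 2) _ p :=
    (hasFDerivAt_apply (𝕜 := ℝ) i p).pow 2
  refine (((h 2).sub (h 0)).sub (h 1)).congr_fderiv ?_
  ext x
  simp
  ring


/-- On the open cone `U = {(u,v,w) : w² - u² - v² > 0}` in ℝ³, the function
`f₀(u,v,w) = √r cos(√r/2) - 2 sin(√r/2)` with `r = w² - u² - v²` is Fréchet
differentiable with derivative `(du,dv,dw) ↦ (1/2) sin(√r/2)(u du + v dv - w dw)`,
and this derivative is nonzero at every zero of `f₀` in `U`: `0` is a regular value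
of `f₀` on `U`. -/
theorem sl2_C0_regular_value :
    ∀ p : Fin 3 → ℝ, p 2 ^ 2 - p 0 ^ 2 - p 1 ^ 2 > 0 →
      HasFDerivAt
        (fun q : Fin 3 → ℝ =>
          Real.sqrt (q 2 ^ 2 - q 0 ^ 2 - q 1 ^ 2) *
              Real.cos (Real.sqrt (q 2 ^ 2 - q 0 ^ 2 - q 1 ^ 2) / 2)
            - 2 * Real.sin (Real.sqrt (q 2 ^ 2 - q 0 ^ 2 - q 1 ^ 2) / 2))
        ((1 / 2 * Real.sin (Real.sqrt (p 2 ^ 2 - p 0 ^ 2 - p 1 ^ 2) / 2)) •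
          (p 0 • (ContinuousLinearMap.proj 0 : (Fin 3 → ℝ) →L[ℝ] ℝ)
            + p 1 • (ContinuousLinearMap.proj 1 : (Fin 3 → ℝ) →L[ℝ] ℝ)
            - p 2 • (ContinuousLinearMap.proj 2 : (Fin 3 → ℝ) →L[ℝ] ℝ))) p ∧
      (Real.sqrt (p 2 ^ 2 - p 0 ^ 2 - p 1 ^ 2) *
            Real.cos (Real.sqrt (p 2 ^ 2 - p 0 ^ 2 - p 1 ^ 2) / 2)
          - 2 * Real.sin (Real.sqrt (p 2 ^ 2 - p 0 ^ 2 - p 1 ^ 2) / 2) = 0 →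
        (1 / 2 * Real.sin (Real.sqrt (p 2 ^ 2 - p 0 ^ 2 - p 1 ^ 2) / 2)) •
          (p 0 • (ContinuousLinearMap.proj 0 : (Fin 3 → ℝ) →L[ℝ] ℝ)
            + p 1 • (ContinuousLinearMap.proj 1 : (Fin 3 → ℝ) →L[ℝ] ℝ)
            - p 2 • (ContinuousLinearMap.proj 2 : (Fin 3 → ℝ) →L[ℝ] ℝ)) ≠ 0) := by
  intro p hp
  have hs : Real.sqrt (p 2 ^ 2 - p 0 ^ 2 - p 1 ^ 2) ≠ 0 := (Real.sqrt_pos.2 hp).ne'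
  refine ⟨?_, fun h hzero => ?_⟩
  · refine ((hasDerivAt_mul_cos_half_sub_two_mul_sin_half _).comp_hasFDerivAt p
      ((hasFDerivAt_lorentz_sq p).sqrt hp.ne')).congr_fderiv ?_
    simp only [smul_smul]
    congr 1
    field_simp
  · have hsin := sin_half_ne_zero_of_mul_cos_half_sub_two_mul_sin_half_eq_zero hs h
    have hw : p 2 ≠ 0 := by
      intro hw
      rw [hw] at hp
      nlinarith [sq_nonneg (p 0), sq_nonneg (p 1)]
    have := congrArg (fun L : (Fin 3 → ℝ) →L[ℝ] ℝ => L (Pi.single 2 1)) hzero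
    simp [hsin, hw] at this
end
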